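/- Let a, b, c, d be nonnegative real numbers with a² + b² = 1, c² + d² > 0, and c² + d² ≤ ac + bd. Then (ad − bc)² ≤ (c² + d²)·(1 − (c² + d²)). -/

import Mathlib

theorem stmt_2 (a b c d : ℝ) (ha : 0 ≤ a) (hb : 0 ≤ b) (hc : 0 ≤ c) (hd : 0 ≤ d)
    (hab : a ^ 2 + b ^ 2 = 1) (hcd : 0 < c ^ 2 + d ^ 2)
    (hle : c ^ 2 + d ^ 2 ≤ a * c + b * d) :
    (a * d - b * c) ^ 2 ≤ (c ^ 2 + d ^ 2) * (1 - (c ^ 2 + d ^ 2)) := by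
  have h1 : (c ^ 2 + d ^ 2) ^ 2 ≤ (a * c + b * d) ^ 2 := pow_le_pow_left₀ hcd.le hle 2
  have h2 : (a * d - b * c) ^ 2 + (a * c + b * d) ^ 2 = c ^ 2 + d ^ 2 := by
    linear_combination (c ^ 2 + d ^ 2) * hab
  linarith
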